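/- arXiv:1905.07028 — 3 statements merged into one kernel-verified Lean document; each statement's English description precedes it below -/
import Mathlib

section
/- Let h be a history from (q₀,s₀) ending at combined state c, let h_loop be a history from c of positive length whose last element is again c, and let h_goal be a goal history from c. Then for every m ≥ 0, the concatenation h·h_loop^m·h_goal is a goal history from (q₀,s₀), its likelihood equals ℓ(h)·(ℓ(h_loop))^m·ℓ(h_goal), and these histories are pairwise distinct for distinct m. -/
open scoped ENNReal

/-- An environment: a stochastic transition function (a probability mass function
on next states for each state/action pair) and an observation function. -/
structure Env (S A O : Type) where
  tr : S → A → PMF S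
  obs : S → O

/-- A finite-state controller. `gam q o = some (some a)` means the labeling function
is defined and yields action `a`; `some none` means it yields `stop`; `none` means
it is undefined.  `del` is the (partial) controller transition function. -/
structure FSC (Q O A : Type) where
  q0 : Q
  gam : Q → O → Option (Option A)
  del : Q → O → Option Q

variable {S A O Q : Type}

/-- One-step transition weight of the combined system.  It is nonzero exactly when
the labeling function is defined and yields a proper action (not `stop`), the
controller transition is defined and matches the next controller state, and the
environment transition has positive probability; in that case it equals
`Δ(s' | s, a)`. -/
noncomputable def stepP (E : Env S A O) (C : FSC Q O A) (c c' : Q × S) : ℝ≥0∞ :=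
  match C.gam c.1 (E.obs c.2) with
  | some (some a) =>
      haveI := Classical.propDecidable (C.del c.1 (E.obs c.2) = some c'.1)
      if C.del c.1 (E.obs c.2) = some c'.1 then E.tr c.2 a c'.2 else 0
  | _ => 0

/-- `h` is a history of the system `⟨E, C⟩` from combined state `c`.
(A history of length `T` is a list with `T + 1` elements.) -/
def IsHistory (E : Env S A O) (C : FSC Q O A) (c : Q × S) (h : List (Q × S)) : Prop :=
  h.head? = some c ∧
  ∀ t (ht : t + 1 < h.length), 0 < stepP E C (h[t]'(by omega)) (h[t + 1]'ht)

/-- The likelihood of a history. -/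
noncomputable def lh (E : Env S A O) (C : FSC Q O A) : List (Q × S) → ℝ≥0∞
  | [] => 1
  | [_] => 1
  | c :: c' :: rest => stepP E C c c' * lh E C (c' :: rest)

/-- A history is terminating if the action at its last combined state is `stop`. -/
def IsTerminating (E : Env S A O) (C : FSC Q O A) (h : List (Q × S)) : Prop :=
  ∃ c, h.getLast? = some c ∧ C.gam c.1 (E.obs c.2) = some none

/-- A goal history: terminating, with final environment state in the goal set `G`. -/
def IsGoal (E : Env S A O) (C : FSC Q O A) (G : Set S) (h : List (Q × S)) : Prop :=
  ∃ c, h.getLast? = some c ∧ C.gam c.1 (E.obs c.2) = some none ∧ c.2 ∈ G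

/-- Concatenation of compatible histories: `h₁` followed by `h₂` with its first
element removed. -/
def hcat (h₁ h₂ : List (Q × S)) : List (Q × S) := h₁ ++ h₂.tail

/-- Total likelihood of termination. -/
noncomputable def LTER (E : Env S A O) (C : FSC Q O A) (c0 : Q × S) : ℝ≥0∞ :=
  ∑' h : {h : List (Q × S) // IsHistory E C c0 h ∧ IsTerminating E C h}, lh E C h.1

/-- Total likelihood of goal termination. -/
noncomputable def LGT (E : Env S A O) (C : FSC Q O A) (G : Set S) (c0 : Q × S) : ℝ≥0∞ :=
  ∑' h : {h : List (Q × S) // IsHistory E C c0 h ∧ IsGoal E C G h}, lh E C h.1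

/-- `m`-fold concatenation of a loop history `hl` from `c` back to `c`
(`hpow c hl 0` is the trivial history `[c]`). -/
def hpow {S Q : Type} (c : Q × S) (hl : List (Q × S)) : ℕ → List (Q × S)
  | 0 => [c]
  | m + 1 => hcat hl (hpow c hl m)

theorem isHistory_iff_isChain (E : Env S A O) (C : FSC Q O A) (c : Q × S)
    (h : List (Q × S)) :
    IsHistory E C c h ↔ h.head? = some c ∧ h.IsChain (fun a b => 0 < stepP E C a b) := by
  rw [IsHistory, List.isChain_iff_getElem]

theorem getLast?_hcat {c : Q × S} {h₁ h₂ : List (Q × S)}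
    (hlast : h₁.getLast? = some c) (hhead : h₂.head? = some c) :
    (hcat h₁ h₂).getLast? = h₂.getLast? := by
  obtain ⟨t, rfl⟩ := List.head?_eq_some_iff.mp hhead
  cases t <;> simp [hcat, hlast, List.getLast?_append, List.getLast?_cons]

theorem IsGoal.hcat {E : Env S A O} {C : FSC Q O A} {G : Set S} {c : Q × S}
    {h₁ h₂ : List (Q × S)} (hg : IsGoal E C G h₂)
    (hlast : h₁.getLast? = some c) (hhead : h₂.head? = some c) :
    IsGoal E C G (hcat h₁ h₂) := by
  rwa [IsGoal, getLast?_hcat hlast hhead]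

theorem IsHistory.hcat {E : Env S A O} {C : FSC Q O A} {c₀ c : Q × S}
    {h₁ h₂ : List (Q × S)} (hh₁ : IsHistory E C c₀ h₁)
    (hlast : h₁.getLast? = some c) (hh₂ : IsHistory E C c h₂) :
    IsHistory E C c₀ (hcat h₁ h₂) := by
  rw [isHistory_iff_isChain] at *
  obtain ⟨t, rfl⟩ := List.head?_eq_some_iff.mp hh₂.1
  refine ⟨by simp [_root_.hcat, hh₁.1], ?_⟩
  rw [_root_.hcat, List.tail_cons, List.isChain_append]
  refine ⟨hh₁.2, hh₂.2.tail, fun x hx y hy => ?_⟩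
  obtain rfl : c = x := by simpa [hlast] using hx
  exact (List.isChain_cons.mp hh₂.2).1 y hy

theorem lh_hcat (E : Env S A O) (C : FSC Q O A) {c : Q × S} {h₁ h₂ : List (Q × S)}
    (hlast : h₁.getLast? = some c) (hhead : h₂.head? = some c) :
    lh E C (hcat h₁ h₂) = lh E C h₁ * lh E C h₂ := by
  obtain ⟨t, rfl⟩ := List.head?_eq_some_iff.mp hhead
  induction h₁ with
  | nil => simp at hlast
  | cons a l ih =>
    cases l with
    | nil =>
      obtain rfl : a = c := by simpa using hlast
      simp [hcat, lh]
    | cons b l =>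
      have := ih (by simpa [List.getLast?_cons_cons] using hlast)
      simp only [hcat, List.tail_cons, List.cons_append, lh] at this ⊢
      rw [this, mul_assoc]

theorem length_hpow (c : Q × S) {hl : List (Q × S)} (hl_pos : 1 ≤ hl.length) (m : ℕ) :
    (hpow c hl m).length = m * (hl.length - 1) + 1 := by
  induction m with
  | zero => simp [hpow]
  | succ m ih =>
    rw [hpow, hcat, List.length_append, List.length_tail, ih, Nat.succ_mul]
    lia

theorem IsHistory.hpow {E : Env S A O} {C : FSC Q O A} {c : Q × S} {hl : List (Q × S)}
    (hh : IsHistory E C c hl) (hlast : hl.getLast? = some c) (m : ℕ) :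
    IsHistory E C c (hpow c hl m) := by
  induction m with
  | zero => simp [_root_.hpow, IsHistory]
  | succ m ih => exact hh.hcat hlast ih

theorem getLast?_hpow {E : Env S A O} {C : FSC Q O A} {c : Q × S} {hl : List (Q × S)}
    (hh : IsHistory E C c hl) (hlast : hl.getLast? = some c) (m : ℕ) :
    (hpow c hl m).getLast? = some c := by
  induction m with
  | zero => simp [hpow]
  | succ m ih => rw [hpow, getLast?_hcat hlast (hh.hpow hlast m).1, ih]

theorem lh_hpow {E : Env S A O} {C : FSC Q O A} {c : Q × S} {hl : List (Q × S)}
    (hh : IsHistory E C c hl) (hlast : hl.getLast? = some c) (m : ℕ) :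
    lh E C (hpow c hl m) = lh E C hl ^ m := by
  induction m with
  | zero => simp [hpow, lh]
  | succ m ih => rw [hpow, lh_hcat E C hlast (hh.hpow hlast m).1, ih, pow_succ']

/-- pumping a loop before a goal history yields, for every `m ≥ 0`,
a goal history with likelihood `ℓ(h)·ℓ(h_loop)^m·ℓ(h_goal)`, and these histories
are pairwise distinct. -/
theorem loop_pump_goal_histories
    {S A O Q : Type} [Fintype S] [Nonempty S] [Fintype A] [Nonempty A]
    [Fintype O] [Nonempty O] [Fintype Q] [Nonempty Q]
    (E : Env S A O) (C : FSC Q O A) (G : Set S)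
    (q₀ : Q) (s₀ : S) (c : Q × S) (h hloop hgoal : List (Q × S))
    (hh : IsHistory E C (q₀, s₀) h) (hend : h.getLast? = some c)
    (hhl : IsHistory E C c hloop) (hlpos : 2 ≤ hloop.length)
    (hlend : hloop.getLast? = some c)
    (hhg : IsHistory E C c hgoal) (hg : IsGoal E C G hgoal) :
    (∀ m : ℕ,
        IsHistory E C (q₀, s₀) (hcat (hcat h (hpow c hloop m)) hgoal) ∧
        IsGoal E C G (hcat (hcat h (hpow c hloop m)) hgoal) ∧
        lh E C (hcat (hcat h (hpow c hloop m)) hgoal)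
          = lh E C h * (lh E C hloop) ^ m * lh E C hgoal) ∧
    Function.Injective (fun m : ℕ => hcat (hcat h (hpow c hloop m)) hgoal) := by
  have hpump (m : ℕ) := hhl.hpow hlend m
  have hlast (m : ℕ) : (hcat h (hpow c hloop m)).getLast? = some c := by
    rw [getLast?_hcat hend (hpump m).1, getLast?_hpow hhl hlend]
  refine ⟨fun m => ⟨(hh.hcat hend (hpump m)).hcat (hlast m) hhg,
    hg.hcat (hlast m) hhg.1, ?_⟩, fun m n hmn => ?_⟩
  · rw [lh_hcat E C (hlast m) hhg.1, lh_hcat E C hend (hpump m).1, lh_hpow hhl hlend]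
  · have hlen := congrArg List.length hmn
    simp only [hcat, List.length_append, List.length_tail,
      length_hpow c (by lia : 1 ≤ hloop.length), Nat.add_sub_cancel] at hlen
    exact Nat.eq_of_mul_eq_mul_right (by lia : 0 < hloop.length - 1) (by lia)
end

section
/- Let h = ⟨(qᵗ,sᵗ)⟩_{t=0,…,m} be a history from (q₀,s₀) such that h^(n) = h^(m) for some n < m and ℓ(h^(0:n)) = ℓ(h^(0:m)). Then Δ(s^(t+1)|s^(t),a^(t)) = 1 for every n ≤ t < m, and there exists no terminating history from the combined state h^(n). -/
open scoped ENNReal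

variable {S A O Q : Type}

theorem stepP_le_one (E : Env S A O) (C : FSC Q O A) (c c' : Q × S) : stepP E C c c' ≤ 1 := by
  unfold stepP
  split
  · split_ifs
    · exact PMF.coe_le_one _ _
    · exact zero_le_one
  · exact zero_le_one

theorem eq_of_stepP_eq_one {E : Env S A O} {C : FSC Q O A} {c c' c'' : Q × S}
    (h1 : stepP E C c c' = 1) (h2 : 0 < stepP E C c c'') : c'' = c' := by
  unfold stepP at h1 h2
  split at h1
  · rename_i a ha
    rw [ha] at h2
    dsimp only at h2
    split_ifs at h1 with hd
    · split_ifs at h2 with hd'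
      · have hs : c''.2 ∈ (E.tr c.2 a).support := (PMF.mem_support_iff _ _).2 h2.ne'
        rw [(PMF.apply_eq_one_iff _ _).1 h1] at hs
        exact Prod.ext (Option.some.inj (hd'.symm.trans hd)) hs
      · exact absurd h2 (lt_irrefl _)
    · exact absurd h1 zero_ne_one
  · exact absurd h1 zero_ne_one

theorem gam_ne_some_none_of_stepP_pos {E : Env S A O} {C : FSC Q O A} {c c' : Q × S}
    (h : 0 < stepP E C c c') : C.gam c.1 (E.obs c.2) ≠ some none := by
  intro hs
  simp [stepP, hs] at h

theorem lh_take_succ (E : Env S A O) (C : FSC Q O A) (h : List (Q × S)) (k : ℕ)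
    (hk : k + 1 < h.length) :
    lh E C (h.take (k + 2)) = lh E C (h.take (k + 1)) * stepP E C h[k] h[k + 1] := by
  induction k generalizing h with
  | zero =>
    match h, hk with
    | a :: b :: l, _ => simp [lh]
  | succ k ih =>
    match h, hk with
    | a :: b :: l, hk =>
      have := ih (b :: l) (by simpa using hk)
      simp only [List.take_succ_cons, List.getElem_cons_succ, lh] at this ⊢
      rw [this, mul_assoc]

theorem lh_take_antitone (E : Env S A O) (C : FSC Q O A) (h : List (Q × S)) {i j : ℕ}
    (hij : i ≤ j) (hj : j < h.length) :
    lh E C (h.take (j + 1)) ≤ lh E C (h.take (i + 1)) := by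
  induction j, hij using Nat.le_induction with
  | base => exact le_rfl
  | succ j _ ih =>
    rw [lh_take_succ E C h j hj]
    exact (mul_le_of_le_one_right' (stepP_le_one ..)).trans (ih (by omega))

theorem lh_take_ne_zero {E : Env S A O} {C : FSC Q O A} {c : Q × S} {h : List (Q × S)}
    (hh : IsHistory E C c h) {k : ℕ} (hk : k < h.length) : lh E C (h.take (k + 1)) ≠ 0 := by
  induction k with
  | zero =>
    match h, hk with
    | a :: l, _ => simp [lh]
  | succ k ih =>
    rw [lh_take_succ E C h k hk]
    exact mul_ne_zero (ih (by omega)) (hh.2 k hk).ne'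

theorem lh_take_ne_top (E : Env S A O) (C : FSC Q O A) (h : List (Q × S)) {k : ℕ}
    (hk : k < h.length) : lh E C (h.take (k + 1)) ≠ ⊤ := by
  refine ne_top_of_le_ne_top ENNReal.one_ne_top
    ((lh_take_antitone E C h (Nat.zero_le k) hk).trans ?_)
  match h, hk with
  | a :: l, _ => simp [lh]

/-- If all transitions along a loop have weight one, then every history starting on the
loop stays on it. -/
theorem IsHistory.exists_eq_of_loop {E : Env S A O} {C : FSC Q O A} {h h' : List (Q × S)}
    {n m : ℕ} (hnm : n < m) (hm : m < h.length) (hrep : h[n] = h[m])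
    (hstep : ∀ t (_ : n ≤ t) (ht : t < m), stepP E C h[t] h[t + 1] = 1)
    (hh' : IsHistory E C h[n] h') (i : ℕ) (hi : i < h'.length) :
    ∃ t, ∃ ht : t < m, n ≤ t ∧ h'[i] = h[t] := by
  induction i with
  | zero =>
    refine ⟨n, hnm, le_rfl, ?_⟩
    have := hh'.1
    rw [List.head?_eq_getElem?, List.getElem?_eq_getElem hi] at this
    exact Option.some.inj this
  | succ i ih =>
    obtain ⟨t, ht, hnt, he⟩ := ih (by omega)
    have hpos := hh'.2 i hi
    rw [he] at hpos
    have hnext := eq_of_stepP_eq_one (hstep t hnt ht) hpos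
    rcases Nat.lt_or_ge (t + 1) m with hlt | hge
    · exact ⟨t + 1, hlt, by omega, hnext⟩
    · obtain rfl : t + 1 = m := by omega
      exact ⟨n, hnm, le_rfl, hnext.trans hrep.symm⟩

/-- a non-decaying loop (`h^(n) = h^(m)` with
`ℓ(h^(0:n)) = ℓ(h^(0:m))`) consists of probability-1 transitions, and no
terminating history exists from the repeated combined state. -/
theorem nondecaying_loop_no_termination
    {S A O Q : Type} [Fintype S] [Nonempty S] [Fintype A] [Nonempty A]
    [Fintype O] [Nonempty O] [Fintype Q] [Nonempty Q]
    (E : Env S A O) (C : FSC Q O A)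
    (q₀ : Q) (s₀ : S) (h : List (Q × S)) (n m : ℕ)
    (hh : IsHistory E C (q₀, s₀) h) (hlen : h.length = m + 1) (hnm : n < m)
    (hrep : h[n]'(by omega) = h[m]'(by omega))
    (hlik : lh E C (h.take (n + 1)) = lh E C h) :
    (∀ t (ht1 : n ≤ t) (ht2 : t < m),
        stepP E C (h[t]'(by omega)) (h[t + 1]'(by omega)) = 1) ∧
    ¬ ∃ h' : List (Q × S),
        IsHistory E C (h[n]'(by omega)) h' ∧ IsTerminating E C h' := by
  have hstep : ∀ t (ht1 : n ≤ t) (ht2 : t < m),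
      stepP E C (h[t]'(by omega)) (h[t + 1]'(by omega)) = 1 := by
    intro t ht1 ht2
    have hfull : h.take (m + 1) = h := List.take_of_length_le hlen.le
    have hle : lh E C (h.take (t + 1)) ≤ lh E C (h.take (t + 2)) :=
      calc lh E C (h.take (t + 1)) ≤ lh E C (h.take (n + 1)) :=
            lh_take_antitone E C h ht1 (by omega)
        _ = lh E C (h.take (m + 1)) := by rw [hlik, hfull]
        _ ≤ lh E C (h.take (t + 2)) := lh_take_antitone E C h ht2 (by omega)
    rw [lh_take_succ E C h t (by omega)] at hle
    refine le_antisymm (stepP_le_one ..) ?_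
    rwa [← ENNReal.mul_le_mul_iff_right (lh_take_ne_zero hh (k := t) (by omega))
      (lh_take_ne_top E C h (k := t) (by omega)), mul_one]
  refine ⟨hstep, ?_⟩
  rintro ⟨h', hh', c, hlast, hterm⟩
  rw [List.getLast?_eq_getElem?, List.getElem?_eq_some_iff] at hlast
  obtain ⟨hi, rfl⟩ := hlast
  obtain ⟨t, ht, hnt, he⟩ := hh'.exists_eq_of_loop hnm (by omega) hrep hstep _ hi
  rw [he] at hterm
  exact gam_ne_some_none_of_stepP_pos (hh.2 t (by omega)) hterm
end

section
/- (Hall-A, noisy.) For every n ≥ 1 consider the environment with states S = {0, 1, …, n+1}, actions A = {L, R}, observations O = {A, B, −} with Ω(0) = A, Ω(n+1) = B and Ω(i) = − otherwise, and noisy transitions: Δ(·|i,R) = (1/2)·(point mass at min(i+1, n+1)) + (1/2)·(point mass at i), and Δ(·|i,L) = (1/2)·(point mass at max(i−1, 0)) + (1/2)·(point mass at i); the planning problem has initial state 0 and goal set G = {0}. Let C be the two-state controller with Q = {q₀, q₁}: γ(q₀,A) = R, δ(q₀,A) = q₀; γ(q₀,−) = R, δ(q₀,−) = q₀; γ(q₀,B)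 = L, δ(q₀,B) = q₁; γ(q₁,−) = L, δ(q₁,−) = q₁; γ(q₁,A) = stop; γ(q₁,B) = L, δ(q₁,B) = q₀. Then for every n ≥ 1, the system has LGT = 1. -/
open scoped ENNReal

variable {S A O Q : Type}

/-- The fair mixture `(1/2)·δ_x + (1/2)·δ_y` of two point masses. -/
noncomputable def halfMix {X : Type} (x y : X) : PMF X :=
  (PMF.bernoulli (1 / 2) (by norm_num)).bind fun b => PMF.pure (if b then x else y)

/-- The noisy Hall-A environment with `n` interior cells: each move succeeds
with probability `1/2` and otherwise leaves the state unchanged. Action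
`true = R` moves right (capped at `n+1`), `false = L` moves left (capped at
`0`). Observations: `0 = A` at cell `0`, `1 = B` at cell `n+1`, `2 = −`
elsewhere. -/
noncomputable def hallEnvNoisy (n : ℕ) : Env (Fin (n + 2)) Bool (Fin 3) where
  tr i a :=
    if a then halfMix (⟨min (i.val + 1) (n + 1), by omega⟩ : Fin (n + 2)) i
    else halfMix (⟨i.val - 1, by have := i.isLt; omega⟩ : Fin (n + 2)) i
  obs i := if i.val = 0 then 0 else if i.val = n + 1 then 1 else 2

/-- The two-state noisy Hall-A controller (`false = q₀`, `true = q₁`):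
`γ(q₀,A) = γ(q₀,−) = R` staying in `q₀`; `γ(q₀,B) = L` moving to `q₁`;
`γ(q₁,−) = L` staying in `q₁`; `γ(q₁,A) = stop`; `γ(q₁,B) = L` moving
back to `q₀`. -/
def hallFSCNoisy : FSC Bool (Fin 3) Bool where
  q0 := false
  gam := fun q o =>
    if q = false then (if o = 1 then some (some false) else some (some true))
    else (if o = 0 then some none else some (some false))
  del := fun q o =>
    if q = false then (if o = 1 then some true else some false)
    else (if o = 2 then some true else if o = 1 then some false else none)

theorem tsum_list_eq_nil_add_cons {X : Type*} (f : List X → ℝ≥0∞) :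
    ∑' t, f t = f [] + ∑' x, ∑' t, f (x :: t) := by
  classical
  rw [ENNReal.tsum_eq_add_tsum_ite []]
  congr 1
  have hinj : Function.Injective (fun p : X × List X => p.1 :: p.2) := by
    rintro ⟨x, t⟩ ⟨y, u⟩ h
    simpa using h
  rw [← ENNReal.tsum_prod, ← hinj.tsum_eq]
  · simp
  · rintro (_ | ⟨x, t⟩) h
    · simp at h
    · exact ⟨(x, t), rfl⟩

set_option linter.deprecated false in
theorem tsum_halfMix_mul {X : Type} (x y : X) (g : X → ℝ≥0∞) :
    ∑' s, halfMix x y s * g s = 2⁻¹ * g x + 2⁻¹ * g y := by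
  classical
  have hb (b : Bool) : PMF.bernoulli (1 / 2) (by norm_num) b = 2⁻¹ := by
    rw [PMF.bernoulli_apply]
    cases b <;> simp
  have hs (s : X) : halfMix x y s * g s =
      2⁻¹ * ((if s = x then 1 else 0) * g s) + 2⁻¹ * ((if s = y then 1 else 0) * g s) := by
    rw [halfMix, PMF.bind_apply, tsum_bool, hb, hb]
    simp only [PMF.pure_apply, Bool.false_eq_true, if_false, if_true]
    ring
  simp [hs, ENNReal.tsum_add]

theorem tsum_stepP_mul_of_some (E : Env S A O) (C : FSC Q O A) {c : Q × S} {a : A} {q : Q}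
    (ha : C.gam c.1 (E.obs c.2) = some (some a)) (hq : C.del c.1 (E.obs c.2) = some q)
    (g : Q × S → ℝ≥0∞) :
    ∑' c', stepP E C c c' * g c' = ∑' s, E.tr c.2 a s * g (q, s) := by
  rw [ENNReal.tsum_prod', tsum_eq_single q]
  · simp [stepP, ha, hq]
  · intro q' h
    simp [stepP, ha, hq, h.symm]

theorem stepP_eq_zero_of_halt (E : Env S A O) (C : FSC Q O A) {c : Q × S}
    (h : C.gam c.1 (E.obs c.2) = some none) (c' : Q × S) : stepP E C c c' = 0 := by
  simp [stepP, h]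

theorem tsum_stepP_le_one (E : Env S A O) (C : FSC Q O A) (c : Q × S) :
    ∑' c', stepP E C c c' ≤ 1 := by
  rcases ha : C.gam c.1 (E.obs c.2) with _ | _ | a
  · simp [stepP, ha]
  · simp [stepP, ha]
  · rcases hq : C.del c.1 (E.obs c.2) with _ | q
    · simp [stepP, ha, hq]
    · have := tsum_stepP_mul_of_some E C ha hq 1
      simp only [Pi.one_apply, mul_one, PMF.tsum_coe] at this
      exact this.le

theorem isHistory_singleton (E : Env S A O) (C : FSC Q O A) (c : Q × S) :
    IsHistory E C c [c] := by
  simp [IsHistory]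

theorem isHistory_cons_cons (E : Env S A O) (C : FSC Q O A) (c c' : Q × S) (t : List (Q × S)) :
    IsHistory E C c (c :: c' :: t) ↔ 0 < stepP E C c c' ∧ IsHistory E C c' (c' :: t) := by
  simp only [IsHistory, List.head?_cons, true_and]
  constructor
  · intro h
    exact ⟨h 0 (by simp), fun k hk => h (k + 1) (by simpa using hk)⟩
  · rintro ⟨h0, h⟩ (_ | k) hk
    · exact h0
    · exact h k (by simpa using hk)

open Classical in
/-- The likelihood of the history `c :: t` if it is a goal history, and `0` otherwise. -/
noncomputable def goalWeight (E : Env S A O) (C : FSC Q O A) (G : Set S) :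
    Q × S → List (Q × S) → ℝ≥0∞
  | c, [] => if C.gam c.1 (E.obs c.2) = some none ∧ c.2 ∈ G then 1 else 0
  | c, c' :: t => stepP E C c c' * goalWeight E C G c' t

open Classical in
theorem goalWeight_eq (E : Env S A O) (C : FSC Q O A) (G : Set S) (c : Q × S)
    (t : List (Q × S)) :
    goalWeight E C G c t =
      if IsHistory E C c (c :: t) ∧ IsGoal E C G (c :: t) then lh E C (c :: t) else 0 := by
  induction t generalizing c with
  | nil => simp [goalWeight, isHistory_singleton, IsGoal, lh]
  | cons c' t ih =>
    have hg : IsGoal E C G (c :: c' :: t) ↔ IsGoal E C G (c' :: t) := by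
      simp [IsGoal]
    rw [goalWeight, ih, isHistory_cons_cons, hg, lh]
    by_cases h0 : stepP E C c c' = 0
    · simp [h0]
    · simp [pos_iff_ne_zero, h0]

theorem LGT_eq_tsum_goalWeight (E : Env S A O) (C : FSC Q O A) (G : Set S) (c : Q × S) :
    LGT E C G c = ∑' t, goalWeight E C G c t := by
  classical
  have h := tsum_subtype {h | IsHistory E C c h ∧ IsGoal E C G h} (lh E C)
  refine h.trans ?_
  rw [tsum_list_eq_nil_add_cons, tsum_eq_single c]
  · simp [goalWeight_eq, Set.indicator_apply, IsHistory]
  · intro c' hc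
    simp [IsHistory, hc]

theorem LGT_eq_one_of_goal (E : Env S A O) (C : FSC Q O A) (G : Set S) {c : Q × S}
    (h : C.gam c.1 (E.obs c.2) = some none) (hG : c.2 ∈ G) : LGT E C G c = 1 := by
  rw [LGT_eq_tsum_goalWeight, tsum_list_eq_nil_add_cons]
  simp [goalWeight, h, hG, stepP_eq_zero_of_halt E C h]

theorem LGT_eq_tsum_stepP (E : Env S A O) (C : FSC Q O A) (G : Set S) {c : Q × S}
    (h : C.gam c.1 (E.obs c.2) ≠ some none) :
    LGT E C G c = ∑' c', stepP E C c c' * LGT E C G c' := by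
  rw [LGT_eq_tsum_goalWeight, tsum_list_eq_nil_add_cons]
  simp [goalWeight, h, ENNReal.tsum_mul_left, LGT_eq_tsum_goalWeight]

theorem tsum_goalWeight_length_lt_le_one (E : Env S A O) (C : FSC Q O A) (G : Set S) (N : ℕ)
    (c : Q × S) : ∑' t, (if t.length < N then goalWeight E C G c t else 0) ≤ 1 := by
  induction N generalizing c with
  | zero => simp
  | succ N ih =>
    rw [tsum_list_eq_nil_add_cons]
    by_cases h : C.gam c.1 (E.obs c.2) = some none
    · simp only [goalWeight, stepP_eq_zero_of_halt E C h, zero_mul, ite_self, tsum_zero, add_zero]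
      split_ifs <;> simp
    · simp only [goalWeight, h, false_and, if_false, ite_self, zero_add, List.length_cons,
        Nat.add_lt_add_iff_right, ← mul_ite_zero, ENNReal.tsum_mul_left]
      exact (ENNReal.tsum_le_tsum fun c' => mul_le_of_le_one_right' (ih c')).trans
        (tsum_stepP_le_one E C c)

theorem LGT_le_one (E : Env S A O) (C : FSC Q O A) (G : Set S) (c : Q × S) :
    LGT E C G c ≤ 1 := by
  rw [LGT_eq_tsum_goalWeight, ENNReal.tsum_eq_iSup_sum]
  refine iSup_le fun s => ?_
  calc ∑ t ∈ s, goalWeight E C G c t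
      = ∑ t ∈ s, (if t.length < s.sup List.length + 1 then goalWeight E C G c t else 0) :=
        Finset.sum_congr rfl fun t ht =>
          (if_pos (Nat.lt_succ_of_le (Finset.le_sup (f := List.length) ht))).symm
    _ ≤ ∑' t, (if t.length < s.sup List.length + 1 then goalWeight E C G c t else 0) :=
        ENNReal.sum_le_tsum s
    _ ≤ 1 := tsum_goalWeight_length_lt_le_one E C G _ c

theorem eq_of_eq_half_add_half {x y : ℝ≥0∞} (hx : x ≠ ∞)
    (h : x = 2⁻¹ * y + 2⁻¹ * x) : x = y := by
  have hxx : 2⁻¹ * x + 2⁻¹ * x = x := by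
    rw [← add_mul, ENNReal.inv_two_add_inv_two, one_mul]
  have h' : 2⁻¹ * x = 2⁻¹ * y :=
    (ENNReal.add_left_inj (ENNReal.mul_ne_top (by simp) hx)).1 (hxx.trans h)
  exact (ENNReal.mul_right_inj (by simp) (by simp)).1 h'

theorem LGT_hall_of_some (n : ℕ) {q q' a : Bool} {i j : Fin (n + 2)}
    (ha : hallFSCNoisy.gam q ((hallEnvNoisy n).obs i) = some (some a))
    (hq : hallFSCNoisy.del q ((hallEnvNoisy n).obs i) = some q')
    (hj : (j : ℕ) = if a then min (i.val + 1) (n + 1) else i.val - 1) :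
    LGT (hallEnvNoisy n) hallFSCNoisy {0} (q, i) =
      2⁻¹ * LGT (hallEnvNoisy n) hallFSCNoisy {0} (q', j) +
        2⁻¹ * LGT (hallEnvNoisy n) hallFSCNoisy {0} (q', i) := by
  rw [LGT_eq_tsum_stepP _ _ _ (by simp [ha]), tsum_stepP_mul_of_some _ _ ha hq]
  have htr : (hallEnvNoisy n).tr i a = halfMix j i := by
    cases a <;> simp only [hallEnvNoisy, if_true, if_false, Bool.false_eq_true] at hj ⊢ <;>
      congr 1 <;> exact Fin.ext hj.symm
  rw [htr, tsum_halfMix_mul]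

theorem LGT_hall_left (n k : ℕ) (hk : k < n + 1) :
    LGT (hallEnvNoisy n) hallFSCNoisy {0} (true, ⟨k, by omega⟩) = 1 := by
  induction k with
  | zero => exact LGT_eq_one_of_goal _ _ _ (by simp [hallFSCNoisy, hallEnvNoisy]) rfl
  | succ k ih =>
    rw [← ih (by omega)]
    have hk' : k ≠ n := by omega
    exact eq_of_eq_half_add_half ((LGT_le_one _ _ _ _).trans_lt ENNReal.one_lt_top).ne
      (LGT_hall_of_some n (a := false) (by simp [hallFSCNoisy, hallEnvNoisy, hk'])
        (by simp [hallFSCNoisy, hallEnvNoisy, hk']) (by simp))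

theorem LGT_hall_right (n k : ℕ) (hk : k ≤ n + 1) :
    LGT (hallEnvNoisy n) hallFSCNoisy {0} (false, ⟨k, by omega⟩) =
      LGT (hallEnvNoisy n) hallFSCNoisy {0} (false, Fin.last (n + 1)) := by
  induction hk using Nat.decreasingInduction with
  | self => rfl
  | of_succ k hk ih =>
    rw [← ih]
    have hk' : k ≠ n + 1 := by omega
    have ho : (hallEnvNoisy n).obs ⟨k, by omega⟩ ≠ 1 := by
      simp only [hallEnvNoisy, hk', if_false]
      split_ifs <;> decide
    exact eq_of_eq_half_add_half ((LGT_le_one _ _ _ _).trans_lt ENNReal.one_lt_top).ne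
      (LGT_hall_of_some n (a := true) (by simp [hallFSCNoisy, ho])
        (by simp [hallFSCNoisy, ho]) (by simp; omega))

/-- Hall-A, noisy: for every `n ≥ 1`, the two-state controller
achieves `LGT = 1` on the noisy Hall-A problem with goal cell `0`. -/
theorem hall_a_noisy_lgt_one (n : ℕ) (hn : 1 ≤ n) :
    LGT (hallEnvNoisy n) hallFSCNoisy ({0} : Set (Fin (n + 2)))
      (false, (0 : Fin (n + 2))) = 1 := by
  have hfin (c) : LGT (hallEnvNoisy n) hallFSCNoisy {0} c ≠ ∞ :=
    ((LGT_le_one _ _ _ _).trans_lt ENNReal.one_lt_top).ne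
  have hx := LGT_hall_of_some n (q := false) (q' := true) (a := false) (i := Fin.last (n + 1))
    (j := ⟨n, by omega⟩) (by simp [hallFSCNoisy, hallEnvNoisy])
    (by simp [hallFSCNoisy, hallEnvNoisy]) (by simp)
  have hy := LGT_hall_of_some n (q := true) (q' := false) (a := false) (i := Fin.last (n + 1))
    (j := ⟨n, by omega⟩) (by simp [hallFSCNoisy, hallEnvNoisy])
    (by simp [hallFSCNoisy, hallEnvNoisy]) (by simp)
  rw [LGT_hall_right n n (by omega), ← add_mul, ENNReal.inv_two_add_inv_two, one_mul] at hy
  rw [LGT_hall_left n n (by omega), hy] at hx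
  exact (LGT_hall_right n 0 (by omega)).trans (eq_of_eq_half_add_half (hfin _) hx)
end
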